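/- There are no integers c, d₁, …, d₁₀ with c > 0, ∑_{i=1}^{10} dᵢ = 3c, ∑_{i=1}^{10} dᵢ² = c², and d₁ ≥ c − 1. -/

import Mathlib

theorem no_isotropic_with_large_d1 :
    ¬ ∃ (c : ℤ) (d : Fin 10 → ℤ),
      0 < c ∧ ∑ i, d i = 3 * c ∧ ∑ i, (d i) ^ 2 = c ^ 2 ∧ c - 1 ≤ d 0 := by
  rintro ⟨c, d, hc, h1, h2, h0⟩
  have key : ∀ x : ℤ, x ≤ x ^ 2 := fun x => Int.le_self_sq x
  rw [Fin.sum_univ_succ] at h1 h2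
  have hs : ∑ i : Fin 9, d i.succ ≤ ∑ i : Fin 9, (d i.succ) ^ 2 :=
    Finset.sum_le_sum fun i _ => key _
  rcases eq_or_lt_of_le h0 with h | h
  · rw [← h] at h1 h2
    nlinarith
  · have h' : c ≤ d 0 := by omega
    nlinarith [mul_nonneg (sub_nonneg.2 h') (by omega : (0 : ℤ) ≤ d 0 + c - 1)]
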